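/- arXiv:2203.02184 — 9 statements merged into one kernel-verified Lean document; each statement's English description precedes it below -/
import Mathlib

section
/- Let (X, d) be a metric space with d(x, y) ≤ 2 for all x, y. Then the cone distance satisfies the triangle inequality: for all α, β, γ ∈ [0,1] and x, y, z ∈ X, |α − γ| + min(α, γ)·d(x, z) ≤ |α − β| + min(α, β)·d(x, y) + |β − γ| + min(β, γ)·d(y, z). -/
open Set

/-- For a metric space of diameter at most 2, the cone distance
satisfies the triangle inequality. -/
theorem cone_dist_triangle {X : Type*} [MetricSpace X] (hd : ∀ x y : X, dist x y ≤ 2) :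
    ∀ α ∈ Icc (0:ℝ) 1, ∀ β ∈ Icc (0:ℝ) 1, ∀ γ ∈ Icc (0:ℝ) 1, ∀ x y z : X,
      |α - γ| + min α γ * dist x z ≤
        |α - β| + min α β * dist x y + (|β - γ| + min β γ * dist y z) := by
  rintro α ⟨hα, -⟩ β ⟨hβ, -⟩ γ ⟨hγ, -⟩ x y z
  have htri := dist_triangle x y z
  rcases le_total (min α γ) β with h | h
  · have h₁ : min α γ * dist x y ≤ min α β * dist x y :=
      mul_le_mul_of_nonneg_right (le_min (min_le_left _ _) h) dist_nonneg
    have h₂ : min α γ * dist y z ≤ min β γ * dist y z :=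
      mul_le_mul_of_nonneg_right (le_min h (min_le_right _ _)) dist_nonneg
    have h₃ := mul_le_mul_of_nonneg_left htri (le_min hα hγ)
    have h₄ := abs_sub_le α β γ
    linarith
  · -- Passing through a point closer to the apex costs `2 * (min α γ - β)` in height.
    obtain ⟨hβα, hβγ⟩ := le_min_iff.mp h
    rw [min_eq_right hβα, min_eq_left hβγ, abs_of_nonneg (sub_nonneg.mpr hβα),
      abs_of_nonpos (sub_nonpos.mpr hβγ)]
    have h₁ := mul_le_mul_of_nonneg_left (hd x z) (sub_nonneg.mpr h)
    have h₂ := mul_le_mul_of_nonneg_left htri hβ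
    have h₃ : |α - γ| + 2 * min α γ = α + γ := by
      rcases le_total α γ with hαγ | hαγ
      · rw [min_eq_left hαγ, abs_of_nonpos (sub_nonpos.mpr hαγ)]
        ring
      · rw [min_eq_right hαγ, abs_of_nonneg (sub_nonneg.mpr hαγ)]
        ring
    linarith
end

section
/- Let (X, d) be a complete metric space with d(x, y) ≤ 2 for all x, y. Then the pseudometric space ([0,1] × X, D), where D is the cone distance, is complete: every sequence (α_n, x_n) that is Cauchy with respect to D admits a point (β, y) ∈ [0,1] × X with D((α_n, x_n), (β, y)) → 0. -/
open Set

/-- The cone distance on `[0,1] × X` (represented on `ℝ × X`). -/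
noncomputable def coneDist {X : Type*} [MetricSpace X] (p q : ℝ × X) : ℝ :=
  |p.1 - q.1| + min p.1 q.1 * dist p.2 q.2

/-- If `X` is a complete metric space of diameter at most 2, then
`([0,1] × X, coneDist)` is complete: every Cauchy sequence admits a limit point. -/
theorem coneDist_complete {X : Type*} [MetricSpace X] [CompleteSpace X]
    (hd : ∀ x y : X, dist x y ≤ 2)
    (u : ℕ → ℝ × X) (hu : ∀ n, (u n).1 ∈ Icc (0:ℝ) 1)
    (hcauchy : ∀ ε > (0:ℝ), ∃ N : ℕ, ∀ m ≥ N, ∀ n ≥ N, coneDist (u m) (u n) < ε) :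
    ∃ p : ℝ × X, p.1 ∈ Icc (0:ℝ) 1 ∧
      Filter.Tendsto (fun n => coneDist (u n) p) Filter.atTop (nhds 0) := by
  have cauchy_fst : CauchySeq fun n => (u n).1 := by
    refine Metric.cauchySeq_iff.2 fun ε hε => ?_
    obtain ⟨N, hN⟩ := hcauchy ε hε
    refine ⟨N, fun m hm n hn => ?_⟩
    have h := hN m hm n hn
    have hnonneg : 0 ≤ min (u m).1 (u n).1 * dist (u m).2 (u n).2 :=
      mul_nonneg (le_min (hu m).1 (hu n).1) dist_nonneg
    rw [Real.dist_eq]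
    unfold coneDist at h
    linarith
  obtain ⟨β, hβ⟩ := cauchySeq_tendsto_of_complete cauchy_fst
  have hβmem : β ∈ Icc (0:ℝ) 1 := isClosed_Icc.mem_of_tendsto hβ (.of_forall hu)
  rcases hβmem.1.eq_or_lt with rfl | hpos
  · refine ⟨(0, (u 0).2), hβmem, hβ.congr fun n => ?_⟩
    simp [coneDist, min_eq_right (hu n).1, abs_of_nonneg (hu n).1]
  · have cauchy_snd : CauchySeq fun n => (u n).2 := by
      refine Metric.cauchySeq_iff.2 fun ε hε => ?_
      obtain ⟨M, hM⟩ := Filter.eventually_atTop.1 (hβ.eventually_const_lt (half_lt_self hpos))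
      obtain ⟨N, hN⟩ := hcauchy (β / 2 * ε) (by positivity)
      refine ⟨max M N, fun m hm n hn => ?_⟩
      have h := hN m (le_of_max_le_right hm) n (le_of_max_le_right hn)
      have hmin : β / 2 ≤ min (u m).1 (u n).1 :=
        le_min (hM m (le_of_max_le_left hm)).le (hM n (le_of_max_le_left hn)).le
      have hmul := mul_le_mul_of_nonneg_right hmin (dist_nonneg (x := (u m).2) (y := (u n).2))
      have habs := abs_nonneg ((u m).1 - (u n).1)
      unfold coneDist at h
      exact lt_of_mul_lt_mul_left (by linarith) (half_pos hpos).le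
    obtain ⟨y, hy⟩ := cauchySeq_tendsto_of_complete cauchy_snd
    refine ⟨(β, y), hβmem, ?_⟩
    have h := (hβ.sub_const β).abs.add
      ((hβ.min (tendsto_const_nhds (x := β))).mul (hy.dist (tendsto_const_nhds (x := y))))
    simpa [coneDist] using h
end

section
/- Let (S, d_S) be a metric space with basepoint 0_S such that ‖s‖ := d_S(s, 0_S) ≤ 1 for all s ∈ S, and let (X, d_X) be a metric space with d_X(x, y) ≤ 2 for all x, y. Then the generalised cone distance ρ is a pseudometric on S × X, and ρ((s, x), (t, y)) = 0 if and only if (s, x) = (t, y) or s = t = 0_S. -/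
/-- The generalised cone distance on `S × X`, for a metric space `S` with
basepoint `z` and a metric space `X`. -/
noncomputable def genConeDist {S X : Type*} [MetricSpace S] [MetricSpace X]
    (z : S) (p q : S × X) : ℝ :=
  max (dist p.1 q.1)
    (|dist p.1 z - dist q.1 z| + min (dist p.1 z) (dist q.1 z) * dist p.2 q.2)

/-- The triangle inequality for the radial part of the cone distance, at points with radii
`a`, `b`, `c` and pairwise angular distances `d`, `e`, `f`. -/
theorem abs_sub_add_min_mul_triangle {a b c d e f : ℝ} (ha : 0 ≤ a) (hb : 0 ≤ b) (hc : 0 ≤ c)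
    (hd : 0 ≤ d) (he : 0 ≤ e) (hf : f ≤ 2) (hfde : f ≤ d + e) :
    |a - c| + min a c * f ≤ (|a - b| + min a b * d) + (|b - c| + min b c * e) := by
  rcases le_total (min a c) b with h | h
  · have h₁ : min a c * d ≤ min a b * d :=
      mul_le_mul_of_nonneg_right (le_min (min_le_left _ _) h) hd
    have h₂ : min a c * e ≤ min b c * e :=
      mul_le_mul_of_nonneg_right (le_min h (min_le_right _ _)) he
    have h₃ : min a c * f ≤ min a c * (d + e) :=
      mul_le_mul_of_nonneg_left hfde (le_min ha hc)
    linarith [abs_sub_le a b c]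
  · have hba : b ≤ a := h.trans (min_le_left _ _)
    have hbc : b ≤ c := h.trans (min_le_right _ _)
    have h₁ : (min a c - b) * f ≤ (min a c - b) * 2 :=
      mul_le_mul_of_nonneg_left hf (sub_nonneg.2 h)
    have h₂ : b * f ≤ b * (d + e) := mul_le_mul_of_nonneg_left hfde hb
    have h₃ : |a - c| + 2 * min a c = a + c := by
      rw [← max_sub_min_eq_abs']
      linarith [min_add_max a c]
    rw [min_eq_right hba, min_eq_left hbc, abs_of_nonneg (sub_nonneg.2 hba),
      abs_of_nonpos (sub_nonpos.2 hbc)]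
    linarith

/-- If `‖s‖ = dist s z ≤ 1` for all `s ∈ S` and `X` has diameter at most 2,
then the generalised cone distance is a pseudometric on `S × X`, vanishing exactly on
the diagonal together with the pairs of root points. -/
theorem genConeDist_pseudometric {S X : Type*} [MetricSpace S] [MetricSpace X] (z : S)
    (hn : ∀ s : S, dist s z ≤ 1) (hd : ∀ x y : X, dist x y ≤ 2) :
    (∀ p q : S × X, 0 ≤ genConeDist z p q) ∧
    (∀ p : S × X, genConeDist z p p = 0) ∧
    (∀ p q : S × X, genConeDist z p q = genConeDist z q p) ∧
    (∀ p q r : S × X, genConeDist z p r ≤ genConeDist z p q + genConeDist z q r) ∧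
    (∀ p q : S × X, genConeDist z p q = 0 ↔ p = q ∨ (p.1 = z ∧ q.1 = z)) := by
  refine ⟨fun p q => le_max_of_le_left dist_nonneg, fun p => by simp [genConeDist],
    fun p q => ?_, fun p q r => ?_, fun p q => ⟨fun h => ?_, ?_⟩⟩
  · simp only [genConeDist, dist_comm p.1 q.1, dist_comm p.2 q.2, abs_sub_comm (dist p.1 z),
      min_comm (dist p.1 z)]
  · exact max_le
      ((dist_triangle _ q.1 _).trans (add_le_add (le_max_left _ _) (le_max_left _ _)))
      ((abs_sub_add_min_mul_triangle dist_nonneg dist_nonneg dist_nonneg dist_nonneg dist_nonneg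
        (hd _ _) (dist_triangle _ q.2 _)).trans (add_le_add (le_max_right _ _) (le_max_right _ _)))
  · have h₁ : p.1 = q.1 := dist_le_zero.1 ((le_max_left _ _).trans h.le)
    have h₂ := (le_max_right _ _).trans h.le
    rw [← h₁, sub_self, abs_zero, zero_add, min_self] at h₂
    have h₃ : dist p.1 z * dist p.2 q.2 = 0 :=
      le_antisymm h₂ (mul_nonneg dist_nonneg dist_nonneg)
    rcases mul_eq_zero.1 h₃ with h₄ | h₄
    · exact Or.inr ⟨dist_eq_zero.1 h₄, h₁ ▸ dist_eq_zero.1 h₄⟩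
    · exact Or.inl (Prod.ext h₁ (dist_eq_zero.1 h₄))
  · rintro (rfl | ⟨hp, hq⟩)
    · simp [genConeDist]
    · simp [genConeDist, hp, hq]
end

section
/- Let X be a metric star space and E ⊆ X a nonempty closed subset. Then the distance function to E is sub-homogeneous, i.e. infdist(α·u, E) ≤ α·infdist(u, E) for all α ∈ [0,1] and u ∈ X, if and only if E is closed under the action, i.e. α·e ∈ E for all α ∈ [0,1] and e ∈ E. -/
/-- A metric star space structure on a metric space `X`: an action of the
multiplicative monoid `[0,1]` with a root, satisfying the star space axioms. -/
structure StarAction (X : Type*) [MetricSpace X] where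
  smul : ℝ → X → X
  root : X
  one_smul : ∀ x, smul 1 x = x
  mul_smul : ∀ α ∈ Set.Icc (0:ℝ) 1, ∀ β ∈ Set.Icc (0:ℝ) 1, ∀ x,
    smul α (smul β x) = smul (α * β) x
  zero_smul : ∀ x, smul 0 x = root
  dist_smul_le : ∀ α ∈ Set.Icc (0:ℝ) 1, ∀ x y,
    dist (smul α x) (smul α y) ≤ α * dist x y
  dist_smul_smul : ∀ α ∈ Set.Icc (0:ℝ) 1, ∀ β ∈ Set.Icc (0:ℝ) 1, ∀ x,
    dist (smul α x) (smul β x) = |α - β| * dist x root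

/-- In a metric star space, the distance to a nonempty closed subset `E`
is sub-homogeneous iff `E` is closed under the action. -/
theorem infDist_subHomogeneous_iff {X : Type*} [MetricSpace X] (S : StarAction X)
    (E : Set X) (hne : E.Nonempty) (hcl : IsClosed E) :
    (∀ α ∈ Set.Icc (0:ℝ) 1, ∀ u : X,
        Metric.infDist (S.smul α u) E ≤ α * Metric.infDist u E) ↔
    (∀ α ∈ Set.Icc (0:ℝ) 1, ∀ e ∈ E, S.smul α e ∈ E) := by
  constructor
  · intro h α hα e he
    rw [hcl.mem_iff_infDist_zero hne]
    refine le_antisymm ?_ Metric.infDist_nonneg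
    simpa [Metric.infDist_zero_of_mem he] using h α hα e
  · intro h α hα u
    have bound : ∀ e ∈ E, Metric.infDist (S.smul α u) E ≤ α * dist u e := fun e he =>
      (Metric.infDist_le_dist_of_mem (h α hα e he)).trans (S.dist_smul_le α hα u e)
    rcases hα.1.eq_or_lt with rfl | hpos
    · obtain ⟨e, he⟩ := hne
      simpa using bound e he
    · rw [← div_le_iff₀' hpos, Metric.le_infDist hne]
      intro e he
      rw [div_le_iff₀' hpos]
      exact bound e he
end

section
/- Let X be a metric star space, k > 0, and φ : X → ℝ with φ ≥ 0. Then SH_k φ is nonnegative, k-Lipschitz (|(SH_k φ)(u) − (SH_k φ)(v)| ≤ k·d(u, v) for all u, v), and satisfies (SH_k φ)(u) ≤ φ(u) for all u ∈ X. -/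
/-- The sub-homogeneous retraction `SH_k φ` of a function `φ : X → ℝ`:
`(SH_k φ)(u) = inf over α ∈ [0,1], u' ∈ X of (α·φ(u') + k·d(α·u', u))`. -/
noncomputable def SH {X : Type*} [MetricSpace X] (S : StarAction X) (k : ℝ)
    (φ : X → ℝ) (u : X) : ℝ :=
  ⨅ p : Set.Icc (0:ℝ) 1 × X, ((p.1 : ℝ) * φ p.2 + k * dist (S.smul p.1 p.2) u)

theorem SH_objective_nonneg {X : Type*} [MetricSpace X] (S : StarAction X)
    {k : ℝ} (hk : 0 ≤ k) {φ : X → ℝ} (hφ : ∀ u, 0 ≤ φ u) (u : X)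
    (p : Set.Icc (0:ℝ) 1 × X) :
    0 ≤ (p.1 : ℝ) * φ p.2 + k * dist (S.smul p.1 p.2) u :=
  add_nonneg (mul_nonneg p.1.2.1 (hφ _)) (mul_nonneg hk dist_nonneg)

theorem SH_le {X : Type*} [MetricSpace X] (S : StarAction X)
    {k : ℝ} (hk : 0 ≤ k) {φ : X → ℝ} (hφ : ∀ u, 0 ≤ φ u) (u : X)
    (p : Set.Icc (0:ℝ) 1 × X) :
    SH S k φ u ≤ (p.1 : ℝ) * φ p.2 + k * dist (S.smul p.1 p.2) u :=
  ciInf_le ⟨0, Set.forall_mem_range.2 (SH_objective_nonneg S hk hφ u)⟩ p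

theorem SH_sub_le {X : Type*} [MetricSpace X] (S : StarAction X)
    {k : ℝ} (hk : 0 ≤ k) {φ : X → ℝ} (hφ : ∀ u, 0 ≤ φ u) (u v : X) :
    SH S k φ u - SH S k φ v ≤ k * dist u v := by
  have : Nonempty X := ⟨u⟩
  have h : SH S k φ u - k * dist u v ≤ SH S k φ v := by
    refine le_ciInf fun p => ?_
    have h₁ := SH_le S hk hφ u p
    have h₂ := mul_le_mul_of_nonneg_left (dist_triangle (S.smul p.1 p.2) v u) hk
    rw [dist_comm v u] at h₂
    linarith
  linarith

/-- For `k > 0` and `φ ≥ 0`, the function `SH_k φ` is nonnegative,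
`k`-Lipschitz, and bounded above by `φ`. -/
theorem SH_nonneg_lipschitz_le {X : Type*} [MetricSpace X] (S : StarAction X)
    (k : ℝ) (hk : 0 < k) (φ : X → ℝ) (hφ : ∀ u, 0 ≤ φ u) :
    (∀ u, 0 ≤ SH S k φ u) ∧
    (∀ u v, |SH S k φ u - SH S k φ v| ≤ k * dist u v) ∧
    (∀ u, SH S k φ u ≤ φ u) := by
  refine ⟨fun u => Real.iInf_nonneg (SH_objective_nonneg S hk.le hφ u),
    fun u v => abs_sub_le_iff.2 ⟨SH_sub_le S hk.le hφ u v, ?_⟩, fun u => ?_⟩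
  · rw [dist_comm]
    exact SH_sub_le S hk.le hφ v u
  · simpa [S.one_smul] using SH_le S hk.le hφ u (⟨1, by norm_num⟩, u)
end

section
/- Let X be a metric star space, k > 0, and φ : X → ℝ sub-homogeneous. Then for every u ∈ X, (SH_k φ)(u) = inf over u' ∈ X of (φ(u') + k·d(u', u)). -/
/-- If `φ` is sub-homogeneous, then
`(SH_k φ)(u) = inf over u' of (φ(u') + k·d(u', u))`. -/
theorem SH_eq_of_subHomogeneous {X : Type*} [MetricSpace X] (S : StarAction X)
    (k : ℝ) (hk : 0 < k) (φ : X → ℝ)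
    (hsh : ∀ α ∈ Set.Icc (0:ℝ) 1, ∀ u, 0 ≤ φ (S.smul α u) ∧ φ (S.smul α u) ≤ α * φ u) :
    ∀ u, SH S k φ u = ⨅ u' : X, (φ u' + k * dist u' u) := by
  intro u
  have : Nonempty X := ⟨u⟩
  have : Nonempty (Set.Icc (0:ℝ) 1 × X) := ⟨⟨1, u⟩⟩
  have hφ : ∀ x, 0 ≤ φ x := fun x => by
    simpa only [S.one_smul] using (hsh 1 (by simp) x).1
  refine le_antisymm (le_ciInf fun x => ?_) (le_ciInf fun p => ?_)
  · refine (ciInf_le ⟨0, ?_⟩ ((1 : Set.Icc (0:ℝ) 1), x)).trans_eq (by simp [S.one_smul])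
    rintro _ ⟨p, rfl⟩
    have := mul_nonneg p.1.2.1 (hφ p.2)
    positivity
  · refine (ciInf_le ⟨0, ?_⟩ (S.smul p.1 p.2)).trans ?_
    · rintro _ ⟨x, rfl⟩
      have := hφ x
      positivity
    · gcongr
      exact (hsh p.1 p.1.2 p.2).2
end

section
/- Let X be a metric star space and φ : X → ℝ sub-homogeneous with φ(u) ≤ M for all u. Suppose δ > 0 and ε ≥ 0 are such that d(u, u') < δ implies |φ(u) − φ(u')| ≤ ε, and let k > 2M/δ. Then φ(u) − ε ≤ (SH_k φ)(u) ≤ φ(u) for all u ∈ X. -/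
/-- If `φ` is sub-homogeneous, bounded by `M`, with modulus of uniform
continuity `(δ, ε)`, and `k > 2M/δ`, then `φ − ε ≤ SH_k φ ≤ φ`. -/
theorem SH_approx {X : Type*} [MetricSpace X] (S : StarAction X)
    (k M δ ε : ℝ) (hk0 : 0 < k) (φ : X → ℝ)
    (hsh : ∀ α ∈ Set.Icc (0:ℝ) 1, ∀ u, 0 ≤ φ (S.smul α u) ∧ φ (S.smul α u) ≤ α * φ u)
    (hM : ∀ u, φ u ≤ M) (hδ : 0 < δ) (hε : 0 ≤ ε)
    (hmod : ∀ u u', dist u u' < δ → |φ u - φ u'| ≤ ε)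
    (hk : 2 * M / δ < k) :
    ∀ u, φ u - ε ≤ SH S k φ u ∧ SH S k φ u ≤ φ u := by
  intro u
  have nonneg : ∀ v, 0 ≤ φ v := fun v => by
    simpa only [S.one_smul] using (hsh 1 ⟨zero_le_one, le_rfl⟩ v).1
  have term_nonneg : ∀ p : Set.Icc (0:ℝ) 1 × X,
      0 ≤ (p.1 : ℝ) * φ p.2 + k * dist (S.smul p.1 p.2) u := fun p =>
    add_nonneg (mul_nonneg p.1.2.1 (nonneg p.2)) (mul_nonneg hk0.le dist_nonneg)
  constructor
  · have : Nonempty (Set.Icc (0:ℝ) 1 × X) := ⟨(1, u)⟩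
    refine le_ciInf fun p => ?_
    have hα := (hsh p.1 p.1.2 p.2).2
    have hαφ : 0 ≤ (p.1 : ℝ) * φ p.2 := mul_nonneg p.1.2.1 (nonneg p.2)
    rcases lt_or_ge (dist (S.smul p.1 p.2) u) δ with h | h
    · have hclose := (abs_le.mp (hmod _ _ h)).1
      have := mul_nonneg hk0.le (dist_nonneg (x := S.smul p.1 p.2) (y := u))
      linarith
    · have hfar := mul_le_mul_of_nonneg_left h hk0.le
      have hkδ := (div_lt_iff₀ hδ).mp hk
      linarith [nonneg u, hM u]
  · refine (ciInf_le ⟨0, ?_⟩ ((1 : Set.Icc (0:ℝ) 1), u)).trans_eq ?_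
    · rintro _ ⟨p, rfl⟩
      exact term_nonneg p
    · simp [S.one_smul]
end

section
/- Let (S, d_S) be a metric star space with ‖s‖ ≤ 1 for all s ∈ S, and let (X, d_X) be a metric space with d_X(x, y) ≤ 2 for all x, y. Equip S × X with the generalised cone distance ρ and the action α·(s, x) = (α·s, x). Then for all α, β ∈ [0,1] and p, q ∈ S × X: ρ(α·p, α·q) ≤ α·ρ(p, q), and ρ(α·p, β·p) = |α − β|·ρ(p, (0_S, x₀)) for any x₀ ∈ X (note ρ((s, x), (0_S, x₀)) = ‖s‖, independent of x₀). -/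
/-- The norm of a star space is homogeneous under the action. -/
theorem StarAction.dist_smul_root {S : Type*} [MetricSpace S] (A : StarAction S)
    {α : ℝ} (hα : α ∈ Set.Icc (0:ℝ) 1) (s : S) :
    dist (A.smul α s) A.root = α * dist s A.root := by
  have h := A.dist_smul_smul α hα 0 (by simp) s
  rwa [A.zero_smul, sub_zero, abs_of_nonneg hα.1] at h

/-- If `S` is a metric star space with `‖s‖ ≤ 1` and `X` has diameter
at most 2, then the generalised cone `S × X`, with the generalised cone distance and
the action `α·(s, x) = (α·s, x)`, satisfies the metric star space distance axioms. -/
theorem genCone_starSpace {S X : Type*} [MetricSpace S] [MetricSpace X]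
    (A : StarAction S) (hn : ∀ s : S, dist s A.root ≤ 1)
    (hd : ∀ x y : X, dist x y ≤ 2) :
    (∀ α ∈ Set.Icc (0:ℝ) 1, ∀ p q : S × X,
      genConeDist A.root (A.smul α p.1, p.2) (A.smul α q.1, q.2)
        ≤ α * genConeDist A.root p q) ∧
    (∀ α ∈ Set.Icc (0:ℝ) 1, ∀ β ∈ Set.Icc (0:ℝ) 1, ∀ p : S × X, ∀ x₀ : X,
      genConeDist A.root (A.smul α p.1, p.2) (A.smul β p.1, p.2)
        = |α - β| * genConeDist A.root p (A.root, x₀)) := by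
  refine ⟨fun α hα p q => ?_, fun α hα β hβ p x₀ => ?_⟩
  · simp only [genConeDist, A.dist_smul_root hα]
    rw [mul_max_of_nonneg _ _ hα.1]
    refine max_le_max (A.dist_smul_le α hα _ _) (le_of_eq ?_)
    rw [← mul_sub, abs_mul, abs_of_nonneg hα.1, ← mul_min_of_nonneg _ _ hα.1]
    ring
  · simp only [genConeDist, A.dist_smul_root hα, A.dist_smul_root hβ,
      A.dist_smul_smul α hα β hβ]
    simp [← sub_mul, abs_mul]
end

section
/- Let (D_n)_{n∈ℕ} be nonempty metric spaces and π_n : D_{n+1} → D_n uniformly continuous surjections. Equip the product P = Π_n D_n with the distance d(x, y) = Σ_n min(2^{−n}, d_n(x_n, y_n)), and let L = {x ∈ P : π_n(x_{n+1}) = x_n for all n}. Then for every ε > 0 there exists δ > 0 such that for every a ∈ P with Σ_n min(2^{−n}, d_n(a_n, π_n(a_{n+1}))) < δ, there exists b ∈ L with d(a, b) < ε. -/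
/-- In an inverse sequence of surjections, every point of every level lies on a thread. -/
theorem exists_thread_through {D : ℕ → Type*} (π : ∀ n, D (n + 1) → D n)
    (hπs : ∀ n, Function.Surjective (π n)) (N : ℕ) (x : D N) :
    ∃ b : (n : ℕ) → D n, (∀ n, π n (b (n + 1)) = b n) ∧ b N = x := by
  induction N generalizing D with
  | zero =>
    exact ⟨fun n => Nat.rec x (fun n y => Function.surjInv (hπs n) y) n,
      fun n => Function.surjInv_eq (hπs n) _, rfl⟩
  | succ N ih =>
    obtain ⟨c, hc, hcN⟩ := ih (D := fun n => D (n + 1)) (fun n => π (n + 1))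
      (fun n => hπs (n + 1)) x
    refine ⟨fun n => Nat.casesOn n (π 0 (c 0)) c, fun n => ?_, hcN⟩
    cases n with
    | zero => rfl
    | succ n => exact hc n

/-- A thread close to an approximate thread at level `N` is close to it at all lower levels. -/
theorem exists_dist_lt_of_approx_thread {D : ℕ → Type*} [∀ n, PseudoMetricSpace (D n)]
    (π : ∀ n, D (n + 1) → D n) (hπc : ∀ n, UniformContinuous (π n)) (N : ℕ) {η : ℝ}
    (hη : 0 < η) :
    ∃ δ > (0 : ℝ), ∀ a b : (n : ℕ) → D n, (∀ n < N, dist (a n) (π n (a (n + 1))) < δ) →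
      (∀ n, π n (b (n + 1)) = b n) → dist (a N) (b N) < δ →
      ∀ n ≤ N, dist (a n) (b n) < η := by
  induction N with
  | zero =>
    refine ⟨η, hη, fun a b _ _ h n hn => ?_⟩
    obtain rfl : n = 0 := by omega
    exact h
  | succ N ih =>
    obtain ⟨δ, hδ, h⟩ := ih
    obtain ⟨γ, hγ, hπ⟩ := Metric.uniformContinuous_iff.1 (hπc N) (δ / 2) (half_pos hδ)
    refine ⟨min η (min γ (δ / 2)), by positivity, fun a b ha hb hab n hn => ?_⟩
    simp only [lt_min_iff] at ha hab
    rcases Nat.le_succ_iff.1 hn with hn | rfl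
    · refine h a b (fun m hm => ?_) hb ?_ n hn
      · linarith [(ha m (by omega)).2.2]
      · have h₁ := hπ hab.2.1
        rw [hb N] at h₁
        linarith [(ha N (by omega)).2.2, dist_triangle (a N) (π N (a (N + 1))) (b N)]
    · exact hab.1

theorem summable_min_inv_two_pow {f : ℕ → ℝ} (hf : ∀ n, 0 ≤ f n) :
    Summable fun n => min (((2 : ℝ) ^ n)⁻¹) (f n) :=
  Summable.of_nonneg_of_le (fun n => le_min (by positivity) (hf n)) (fun n => min_le_left _ _)
    (by simpa only [one_div, inv_pow] using summable_geometric_two)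

theorem tsum_min_inv_two_pow_le {f : ℕ → ℝ} (hf : ∀ n, 0 ≤ f n) {N : ℕ} {η : ℝ}
    (h : ∀ n ≤ N, f n ≤ η) :
    ∑' n, min (((2 : ℝ) ^ n)⁻¹) (f n) ≤ (N + 1) * η + ((2 : ℝ) ^ N)⁻¹ := by
  have hs := summable_min_inv_two_pow hf
  rw [← hs.sum_add_tsum_nat_add (N + 1)]
  refine add_le_add ?_ ?_
  · calc ∑ n ∈ Finset.range (N + 1), min (((2 : ℝ) ^ n)⁻¹) (f n)
        ≤ ∑ _n ∈ Finset.range (N + 1), η := Finset.sum_le_sum fun n hn =>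
          (min_le_right _ _).trans (h n (by simpa [Nat.lt_succ_iff] using hn))
      _ = (N + 1) * η := by simp
  · have hg : HasSum (fun n : ℕ => ((2 : ℝ) ^ (n + (N + 1)))⁻¹) (((2 : ℝ) ^ N)⁻¹) := by
      have hfun : (fun n : ℕ => ((2 : ℝ) ^ (n + (N + 1)))⁻¹) =
          fun n => (1 / 2 : ℝ) ^ n * ((2 : ℝ) ^ (N + 1))⁻¹ := by
        funext n
        rw [pow_add, mul_inv, one_div, inv_pow]
      have hsum : ((2 : ℝ) ^ N)⁻¹ = 2 * ((2 : ℝ) ^ (N + 1))⁻¹ := by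
        rw [pow_succ]
        field_simp
      rw [hfun, hsum]
      exact hasSum_geometric_two.mul_right _
    rw [← hg.tsum_eq]
    exact ((summable_nat_add_iff (N + 1)).2 hs).tsum_le_tsum (fun n => min_le_left _ _)
      hg.summable


/-- For an inverse system of nonempty metric spaces with uniformly
continuous surjective bonding maps, points of the product that almost satisfy the
inverse-limit equations are close to the inverse limit. -/
theorem inverseLimit_almost_definable {D : ℕ → Type*} [∀ n, MetricSpace (D n)]
    [∀ n, Nonempty (D n)] (π : ∀ n, D (n + 1) → D n)
    (hπc : ∀ n, UniformContinuous (π n)) (hπs : ∀ n, Function.Surjective (π n)) :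
    ∀ ε > (0:ℝ), ∃ δ > (0:ℝ), ∀ a : (n : ℕ) → D n,
      (∑' n : ℕ, min (((2:ℝ) ^ n)⁻¹) (dist (a n) (π n (a (n + 1))))) < δ →
      ∃ b : (n : ℕ) → D n, (∀ n, π n (b (n + 1)) = b n) ∧
        (∑' n : ℕ, min (((2:ℝ) ^ n)⁻¹) (dist (a n) (b n))) < ε := by
  intro ε hε
  obtain ⟨N, hN⟩ := exists_pow_lt_of_lt_one (half_pos hε) (by norm_num : (2 : ℝ)⁻¹ < 1)
  rw [inv_pow] at hN
  obtain ⟨δ, hδ, h⟩ := exists_dist_lt_of_approx_thread π hπc N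
    (show 0 < ε / 2 / (N + 1) by positivity)
  refine ⟨min δ (((2 : ℝ) ^ N)⁻¹), by positivity, fun a ha => ?_⟩
  obtain ⟨b, hb, hbN⟩ := exists_thread_through π hπs N (a N)
  refine ⟨b, hb, ?_⟩
  have hclose := h a b (fun n hn => ?_) hb (by simpa [hbN] using hδ)
  · have hle := tsum_min_inv_two_pow_le (f := fun n => dist (a n) (b n))
      (fun n => dist_nonneg) fun n hn => (hclose n hn).le
    rw [mul_div_cancel₀ _ (by positivity)] at hle
    linarith
  · have hterm := ((summable_min_inv_two_pow
      (f := fun n => dist (a n) (π n (a (n + 1)))) fun n => dist_nonneg).le_tsum n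
      fun m _ => le_min (by positivity) dist_nonneg).trans_lt ha
    have hpow : ((2 : ℝ) ^ N)⁻¹ ≤ ((2 : ℝ) ^ n)⁻¹ := by
      gcongr
      norm_num
    rcases min_lt_iff.1 hterm with hlt | hlt
    · exact absurd (hlt.trans_le (min_le_right _ _)) hpow.not_gt
    · exact hlt.trans_le (min_le_left _ _)
end
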